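/- Let K be a commutative ring with unity, let v, w : ℤ → K, and let α, β ∈ ℤ. For all integers 0 ≤ k ≤ n, the V-Stirling numbers of the first kind satisfy the horizontal recurrence c^V_{α,β}[n,k] = ∑_{j=k}^{n} (-1)^{j-k} · (v(α+n)·w(β-1))^{j-k} · c^V_{α,β-1}[n+1,j+1]. -/

import Mathlib

open Finset Polynomial

variable {K : Type*} [CommRing K]

/-- Elementary symmetric function `e_t` of the entries of a list. -/
def esymmList : List K → ℕ → K
  | _, 0 => 1
  | [], _ + 1 => 0
  | a :: l, t + 1 => a * esymmList l t + esymmList l (t + 1)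

/-- Complete homogeneous symmetric function `h_t` of the entries of a list. -/
def hsymmList : List K → ℕ → K
  | _, 0 => 1
  | [], _ + 1 => 0
  | a :: l, t + 1 => a * hsymmList (a :: l) t + hsymmList l (t + 1)
  termination_by l t => (l.length, t)

/-- The V-Stirling number of the first kind
`c^V_{α,β}[n,k] = e_{n-k}(v(α+n-1)w(β), …, v(α)w(β+n-1))`,
set to `0` unless `0 ≤ k ≤ n`. -/
def cV (v w : ℤ → K) (α β n k : ℤ) : K :=
  if 0 ≤ k ∧ k ≤ n then
    esymmList (List.ofFn fun j : Fin n.toNat =>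
      v (α + n - 1 - (j : ℕ)) * w (β + (j : ℕ))) (n - k).toNat
  else 0

/-- The V-Stirling number of the second kind
`S^V_{α,β}[n,k] = h_{n-k}(v(α+k)w(β), …, v(α)w(β+k))`,
set to `0` unless `0 ≤ k ≤ n`. -/
def SV (v w : ℤ → K) (α β n k : ℤ) : K :=
  if 0 ≤ k ∧ k ≤ n then
    hsymmList (List.ofFn fun j : Fin (k.toNat + 1) =>
      v (α + k - (j : ℕ)) * w (β + (j : ℕ))) (n - k).toNat
  else 0

theorem esymmList_zero (l : List K) : esymmList l 0 = 1 := by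
  cases l <;> rfl

theorem esymmList_eq_sum_cons (a : K) (l : List K) (t : ℕ) :
    esymmList l t = ∑ i ∈ range (t + 1), (-a) ^ i * esymmList (a :: l) (t - i) := by
  induction t with
  | zero => simp [esymmList_zero]
  | succ t ih =>
    have hcons : esymmList (a :: l) (t + 1) = a * esymmList l t + esymmList l (t + 1) := rfl
    have hshift : ∑ i ∈ range (t + 1), (-a) ^ (i + 1) * esymmList (a :: l) (t + 1 - (i + 1)) =
        -a * esymmList l t := by
      rw [ih, mul_sum]
      refine sum_congr rfl fun i _ => ?_
      rw [Nat.add_sub_add_right]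
      ring
    rw [sum_range_succ', hshift, pow_zero, Nat.sub_zero, hcons]
    ring

/-- The argument list of `cV v w α β n k`, as a function of a natural number `n`. -/
def cVArgs (v w : ℤ → K) (α β : ℤ) (n : ℕ) : List K :=
  List.ofFn fun j : Fin n => v (α + n - 1 - (j : ℕ)) * w (β + (j : ℕ))

theorem cV_natCast (v w : ℤ → K) (α β : ℤ) {n k : ℕ} (hkn : k ≤ n) :
    cV v w α β n k = esymmList (cVArgs v w α β n) (n - k) := by
  have hsub : ((n : ℤ) - k).toNat = n - k := by omega
  rw [cV, if_pos (by omega), hsub]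
  rfl

theorem cVArgs_succ (v w : ℤ → K) (α β : ℤ) (n : ℕ) :
    cVArgs v w α (β - 1) (n + 1) = v (α + n) * w (β - 1) :: cVArgs v w α β n := by
  rw [cVArgs, List.ofFn_succ, cVArgs]
  congr 1
  · congr 2 <;> push_cast [Fin.val_zero] <;> ring
  · congr 1
    funext j
    congr 2 <;> push_cast [Fin.val_succ] <;> ring

theorem cV_horizontal_recurrence (v w : ℤ → K) (α β : ℤ) (n k : ℕ) (hkn : k ≤ n) :
    cV v w α β (n : ℕ) (k : ℕ) =
      ∑ j ∈ Finset.Icc k n,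
        (-1 : K) ^ (j - k) * (v (α + (n : ℕ)) * w (β - 1)) ^ (j - k) *
          cV v w α (β - 1) ((n : ℕ) + 1) ((j : ℕ) + 1) := by
  rw [cV_natCast v w α β hkn, esymmList_eq_sum_cons (v (α + n) * w (β - 1)),
    ← Ico_add_one_right_eq_Icc, sum_Ico_eq_sum_range, Nat.sub_add_comm hkn]
  refine sum_congr rfl fun i hi => ?_
  have hi' : i < n - k + 1 := mem_range.mp hi
  have hc := cV_natCast v w α (β - 1) (n := n + 1) (k := k + i + 1) (by omega)
  have hsub : n + 1 - (k + i + 1) = n - k - i := by omega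
  rw [cVArgs_succ, hsub] at hc
  rw [Nat.add_sub_cancel_left, ← mul_pow, neg_one_mul, ← hc]
  norm_cast
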